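/- There exists a constant ε > 0 such that for all sufficiently large even n the following holds. Let f : {0,1}ⁿ → {0,1} be the partial function with f(z)=1 if |z|=n/2 and f(z)=0 if |z|=0, and let g be the confounding gadget. Then rank₀₁(f∘gⁿ) ≥ 2^{ε·√(n·log₂ n)}. -/

import Mathlib

/-- The Hamming weight of `z ∈ {0,1}ⁿ`. -/
def hw {n : ℕ} (z : Fin n → Bool) : ℕ :=
  (Finset.univ.filter fun i => z i = true).card

/-- The partial function `f : {0,1}ⁿ → {0,1}` with `f z = 1` if `|z| = n/2` and
`f z = 0` if `|z| = 0` (undefined, i.e. `none`, elsewhere). -/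
def fPartial (n : ℕ) (z : Fin n → Bool) : Option Bool :=
  if hw z = n / 2 then some true else if hw z = 0 then some false else none

/-- `gⁿ(x,y) = (g(x₁,y₁), …, g(xₙ,yₙ))`. -/
def gpow {b n : ℕ} (g : (Fin b → Bool) → (Fin b → Bool) → Bool)
    (x y : Fin n → Fin b → Bool) : Fin n → Bool :=
  fun i => g (x i) (y i)

/-- The composed partial 0-1 matrix `f ∘ gⁿ`, with rows indexed by
`x ∈ ({0,1}^b)ⁿ` and columns by `y ∈ ({0,1}^b)ⁿ`; `none` denotes a `*` entry. -/
def composed (b n : ℕ) (g : (Fin b → Bool) → (Fin b → Bool) → Bool)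
    (x y : Fin n → Fin b → Bool) : Option Bool :=
  fPartial n (gpow g x y)

/-- The inner product modulo 2 gadget on `b`-bit strings. -/
def IP (b : ℕ) (u v : Fin b → Bool) : Bool :=
  decide ((∑ i : Fin b, (u i).toNat * (v i).toNat) % 2 = 1)

/-- The number of bits `b(n) = ⌈100 log₂ n⌉` of the confounding gadget. -/
noncomputable def bOf (n : ℕ) : ℕ := ⌈(100 : ℝ) * Real.logb 2 n⌉₊

/-- A total entrywise-nonnegative matrix agreeing with the partial 0-1 matrix `M` on its
non-`*` entries is a sum of `r` entrywise-nonnegative rank-at-most-1 real matrices. -/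
def PNNDecomp {α β : Type*} (M : α → β → Option Bool) (r : ℕ) : Prop :=
  ∃ (u : Fin r → α → ℝ) (v : Fin r → β → ℝ),
    (∀ k i, 0 ≤ u k i) ∧ (∀ k j, 0 ≤ v k j) ∧
    ∀ i j, (M i j = some true → ∑ k, u k i * v k j = 1) ∧
      (M i j = some false → ∑ k, u k i * v k j = 0)

/-- The nonnegative rank of a partial 0-1 matrix. -/
noncomputable def pnnRank {α β : Type*} (M : α → β → Option Bool) : ℕ :=
  sInf {r | PNNDecomp M r}

/-- `r` combinatorial rectangles such that every 1-entry of the partial 0-1 matrix `M`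
lies in exactly one of them and no 0-entry lies in any of them. -/
def PBinCover {α β : Type*} (M : α → β → Option Bool) (r : ℕ) : Prop :=
  ∃ (A : Fin r → Set α) (B : Fin r → Set β),
    (∀ i j, M i j = some true → ∃! k : Fin r, i ∈ A k ∧ j ∈ B k) ∧
    (∀ i j, M i j = some false → ∀ k : Fin r, ¬(i ∈ A k ∧ j ∈ B k))

/-- The binary rank of a partial 0-1 matrix: the minimum number of rectangles covering
each 1-entry exactly once and no 0-entry. -/
noncomputable def pbinRank {α β : Type*} (M : α → β → Option Bool) : ℕ :=
  sInf {r | PBinCover M r}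

open Finset

section Disjoint

variable {α β ι : Type*} [DecidableEq α] [DecidableEq β] [DecidableEq ι]

/-- Yannakakis' argument: if a family of rectangles, pairwise disjoint inside `X × Y`, avoids
`Z`, then some subrectangle of `X × Y` avoids the whole family and contains a large part
of `Z`. -/
theorem exists_subrectangle_avoiding (A : ι → Finset α) (B : ι → Finset β) (Z : Finset (α × β))
    (r : ℕ) (t : ℕ) : ∀ (S : Finset ι) (X : Finset α) (Y : Finset β),
    #S < 2 ^ t → #S ≤ r →
    (∀ k ∈ S, ∀ l ∈ S, k ≠ l →
      (∀ x ∈ X, ¬(x ∈ A k ∧ x ∈ A l)) ∨ (∀ y ∈ Y, ¬(y ∈ B k ∧ y ∈ B l))) →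
    (∀ z ∈ Z, ∀ k ∈ S, ¬(z.1 ∈ A k ∧ z.2 ∈ B k)) →
    ∃ X' ⊆ X, ∃ Y' ⊆ Y, (∀ k ∈ S, ∀ x ∈ X', ∀ y ∈ Y', ¬(x ∈ A k ∧ y ∈ B k)) ∧
      #(Z ∩ X ×ˢ Y) ≤ #(Z ∩ X' ×ˢ Y') * (r + 1) ^ t := by
  induction t with
  | zero =>
    intro S X Y hS _ _ _
    have hS' : S = ∅ := by
      rw [← card_eq_zero]; simpa using hS
    subst hS'
    exact ⟨X, Subset.rfl, Y, Subset.rfl, by simp, by simp⟩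
  | succ t ih =>
    intro S X Y hS hr hdis hZ
    classical
    let R : ι → Finset ι := fun k => S.filter fun l => l ≠ k ∧ ∃ x ∈ X, x ∈ A k ∧ x ∈ A l
    let C : ι → Finset ι := fun k => S.filter fun l => l ≠ k ∧ ∃ y ∈ Y, y ∈ B k ∧ y ∈ B l
    have hRC : ∀ k ∈ S, #(R k) + #(C k) + 1 ≤ #S := by
      intro k hk
      have hd : Disjoint (R k) (C k) := by
        rw [disjoint_left]
        intro l hl hl'
        simp only [R, C, mem_filter] at hl hl'
        obtain ⟨hlS, hlk, x, hx, hxA⟩ := hl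
        obtain ⟨_, _, y, hy, hyB⟩ := hl'
        rcases hdis k hk l hlS (Ne.symm hlk) with h | h
        · exact h x hx hxA
        · exact h y hy hyB
      rw [← card_union_of_disjoint hd, ← card_erase_add_one hk]
      gcongr
      intro l hl
      simp only [R, C, mem_union, mem_filter, mem_erase] at hl ⊢
      tauto
    let good : ι → Prop := fun k => 2 * #(R k) + 1 ≤ #S
    have hbad : ∀ k ∈ S, ¬ good k → 2 * #(C k) + 1 ≤ #S := by
      intro k hk hg
      have := hRC k hk
      simp only [good] at hg
      omega
    let PX : ι → Finset α := fun k => X.filter fun x => if good k then x ∈ A k else x ∉ A k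
    let PY : ι → Finset β := fun k => Y.filter fun y => if good k then y ∉ B k else y ∈ B k
    let FX : Finset α := X.filter fun x => ∀ k ∈ S, good k → x ∉ A k
    let FY : Finset β := Y.filter fun y => ∀ k ∈ S, ¬ good k → y ∉ B k
    set m := #(Z ∩ X ×ˢ Y) with hm
    by_cases hF : m ≤ #(Z ∩ FX ×ˢ FY) * (r + 1)
    · refine ⟨FX, filter_subset _ _, FY, filter_subset _ _, ?_, hF.trans ?_⟩
      · intro k hk x hx y hy h
        simp only [FX, FY, mem_filter] at hx hy
        by_cases hg : good k
        · exact hx.2 k hk hg h.1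
        · exact hy.2 k hk hg h.2
      · gcongr
        exact Nat.le_self_pow (by omega) _
    by_cases hP : ∃ k ∈ S, m ≤ #(Z ∩ PX k ×ˢ PY k) * (r + 1)
    · obtain ⟨k, hk, hmk⟩ := hP
      have key : ∀ T ⊆ S, 2 * #T + 1 ≤ #S →
          (∀ l ∈ S, l ∉ T → ∀ x ∈ PX k, ∀ y ∈ PY k, ¬(x ∈ A l ∧ y ∈ B l)) →
          ∃ X' ⊆ X, ∃ Y' ⊆ Y, (∀ k ∈ S, ∀ x ∈ X', ∀ y ∈ Y', ¬(x ∈ A k ∧ y ∈ B k)) ∧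
            m ≤ #(Z ∩ X' ×ˢ Y') * (r + 1) ^ (t + 1) := by
        intro T hTS hT hav
        obtain ⟨X', hX', Y', hY', h1, h2⟩ := ih T (PX k) (PY k) (by rw [pow_succ] at hS; omega)
          (by omega) (fun a ha c hc hac => by
            rcases hdis a (hTS ha) c (hTS hc) hac with h | h
            · exact Or.inl fun x hx => h x (filter_subset _ _ hx)
            · exact Or.inr fun y hy => h y (filter_subset _ _ hy))
          (fun z hz a ha => hZ z hz a (hTS ha))
        refine ⟨X', hX'.trans (filter_subset _ _), Y', hY'.trans (filter_subset _ _), ?_, ?_⟩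
        · intro l hl x hx y hy
          by_cases hlT : l ∈ T
          · exact h1 l hlT x hx y hy
          · exact hav l hl hlT x (hX' hx) y (hY' hy)
        · calc m ≤ _ := hmk
            _ ≤ (#(Z ∩ X' ×ˢ Y') * (r + 1) ^ t) * (r + 1) := by gcongr
            _ = _ := by ring
      by_cases hg : good k
      · refine key (R k) (filter_subset _ _) hg ?_
        intro l hl hlR x hx y hy h
        simp only [PX, PY, R, mem_filter, hg, if_true] at hx hy hlR
        by_cases hlk : l = k
        · subst hlk; exact hy.2 h.2
        · exact hlR ⟨hl, hlk, x, hx.1, hx.2, h.1⟩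
      · refine key (C k) (filter_subset _ _) (hbad k hk hg) ?_
        intro l hl hlC x hx y hy h
        simp only [PX, PY, C, mem_filter, hg, if_false] at hx hy hlC
        by_cases hlk : l = k
        · subst hlk; exact hx.2 h.1
        · exact hlC ⟨hl, hlk, y, hy.1, hy.2, h.2⟩
    · exfalso
      push Not at hP hF
      have hcov : Z ∩ X ×ˢ Y ⊆ (Z ∩ FX ×ˢ FY) ∪ S.biUnion fun k => Z ∩ PX k ×ˢ PY k := by
        rintro ⟨x, y⟩ hz
        simp only [mem_inter, mem_product] at hz
        obtain ⟨hzZ, hx, hy⟩ := hz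
        simp only [mem_union, mem_biUnion, mem_inter, mem_product, hzZ, true_and]
        by_contra! hcon
        obtain ⟨hcF, hcP⟩ := hcon
        have h1 : ∀ k ∈ S, good k → x ∉ A k := by
          intro k hk hg hxk
          refine hcP k hk ?_ ?_
          · simp [PX, hg, hx, hxk]
          · have := hZ _ hzZ k hk
            simp only [not_and] at this
            simp [PY, hg, hy, this hxk]
        have h2 : ∀ k ∈ S, ¬ good k → y ∉ B k := by
          intro k hk hg hyk
          refine hcP k hk ?_ ?_
          · have := hZ _ hzZ k hk
            simp only [not_and'] at this
            simp [PX, hg, hx, this hyk]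
          · simp [PY, hg, hy, hyk]
        exact hcF (by simpa [FX] using ⟨hx, h1⟩) (by simpa [FY] using ⟨hy, h2⟩)
      have h1 : m ≤ #(Z ∩ FX ×ˢ FY) + ∑ k ∈ S, #(Z ∩ PX k ×ˢ PY k) :=
        (card_le_card hcov).trans ((card_union_le _ _).trans
          (Nat.add_le_add_left card_biUnion_le _))
      have h2 : (∑ k ∈ S, #(Z ∩ PX k ×ˢ PY k)) * (r + 1) ≤ #S * m := by
        rw [sum_mul, ← smul_eq_mul, ← sum_const]
        exact sum_le_sum fun k hk => (hP k hk).le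
      have h3 : m * (r + 1) ≤ (#(Z ∩ FX ×ˢ FY) + ∑ k ∈ S, #(Z ∩ PX k ×ˢ PY k)) * (r + 1) := by
        gcongr
      have h4 : #S * m ≤ r * m := by gcongr
      nlinarith

end Disjoint

/-- The sign `(-1)^p` of a bit. -/
def bitSign (p : Bool) : ℝ := if p then -1 else 1

theorem bitSign_sq (p : Bool) : bitSign p * bitSign p = 1 := by cases p <;> simp [bitSign]

theorem abs_bitSign (p : Bool) : |bitSign p| = 1 := by cases p <;> simp [bitSign]

theorem bitSign_IP {b : ℕ} (u v : Fin b → Bool) :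
    bitSign (IP b u v) = ∏ j, bitSign (u j && v j) := by
  have h1 : ∀ j, bitSign (u j && v j) = (-1) ^ ((u j).toNat * (v j).toNat) := by
    intro j
    cases u j <;> cases v j <;> simp [bitSign]
  simp_rw [h1, prod_pow_eq_pow_sum]
  rcases Nat.even_or_odd (∑ i : Fin b, (u i).toNat * (v i).toNat) with h | h
  · rw [h.neg_one_pow]
    simp [IP, bitSign, Nat.even_iff.mp h]
  · rw [h.neg_one_pow]
    simp [IP, bitSign, Nat.odd_iff.mp h]

theorem sum_bitSign_and_mul (p q : Bool) :
    ∑ a : Bool, bitSign (a && p) * bitSign (a && q) = if p = q then 2 else 0 := by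
  cases p <;> cases q <;> norm_num [bitSign]

/-- Orthogonality of the rows of the inner product matrix. -/
theorem sum_bitSign_IP_mul {b : ℕ} (v v' : Fin b → Bool) :
    ∑ u, bitSign (IP b u v) * bitSign (IP b u v') = if v = v' then 2 ^ b else 0 := by
  simp_rw [bitSign_IP, ← prod_mul_distrib]
  rw [← Fintype.piFinset_univ, ← prod_univ_sum (fun _ => univ)
    (fun j a => bitSign (a && v j) * bitSign (a && v' j))]
  simp_rw [sum_bitSign_and_mul]
  split_ifs with h
  · subst h; simp
  · obtain ⟨j, hj⟩ := Function.ne_iff.mp h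
    exact prod_eq_zero (mem_univ j) (by simp [hj])

theorem sum_prod_bitSign_IP_mul {κ : Type*} [Fintype κ] [DecidableEq κ] {b : ℕ}
    (v v' : κ → Fin b → Bool) :
    ∑ u : κ → Fin b → Bool, (∏ i, bitSign (IP b (u i) (v i))) * ∏ i, bitSign (IP b (u i) (v' i)) =
      if v = v' then (2 ^ b) ^ Fintype.card κ else 0 := by
  simp_rw [← prod_mul_distrib]
  rw [← Fintype.piFinset_univ, ← prod_univ_sum (fun _ => univ)
    (fun i a => bitSign (IP b a (v i)) * bitSign (IP b a (v' i)))]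
  simp_rw [sum_bitSign_IP_mul]
  split_ifs with h
  · subst h; simp
  · obtain ⟨j, hj⟩ := Function.ne_iff.mp h
    exact prod_eq_zero (mem_univ j) (by simp [hj])

section Blocks

variable {n b : ℕ}

/-- The elements of `X` agreeing with `a` on the blocks in `K`. -/
def fiberOn (X : Finset (Fin n → Fin b → Bool)) (K : Finset (Fin n)) (a : Fin n → Fin b → Bool) :
    Finset (Fin n → Fin b → Bool) :=
  X.filter fun x => ∀ i ∈ K, x i = a i

theorem mem_fiberOn {X : Finset (Fin n → Fin b → Bool)} {K : Finset (Fin n)}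
    {a x : Fin n → Fin b → Bool} : x ∈ fiberOn X K a ↔ x ∈ X ∧ ∀ i ∈ K, x i = a i :=
  mem_filter

theorem card_fiberOn_mul_le (X : Finset (Fin n → Fin b → Bool)) (K : Finset (Fin n))
    (a : Fin n → Fin b → Bool) : #(fiberOn X K a) * (2 ^ b) ^ #K ≤ (2 ^ b) ^ n := by
  have h1 : fiberOn X K a ⊆ Fintype.piFinset fun i => if i ∈ K then {a i} else univ := by
    intro x hx
    rw [mem_fiberOn] at hx
    rw [Fintype.mem_piFinset]
    intro i
    split_ifs with h
    · simpa using hx.2 i h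
    · simp
  refine (Nat.mul_le_mul_right _ (card_le_card h1)).trans ?_
  have h2 : (2 ^ b) ^ #K = ∏ i : Fin n, if i ∈ K then 2 ^ b else 1 := by
    rw [prod_ite_mem, prod_const, univ_inter]
  rw [Fintype.card_piFinset, h2, ← prod_mul_distrib]
  refine (prod_le_prod' (g := fun _ => 2 ^ b) fun i _ => ?_).trans (by simp)
  split_ifs <;> simp

theorem fiberOn_fiberOn {X : Finset (Fin n → Fin b → Bool)} {I K : Finset (Fin n)}
    {a x : Fin n → Fin b → Bool} (hx : x ∈ fiberOn X I a) :
    fiberOn (fiberOn X I a) K x = fiberOn X (I ∪ K) x := by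
  rw [mem_fiberOn] at hx
  ext y
  simp only [mem_fiberOn, mem_union]
  constructor
  · rintro ⟨⟨h1, h2⟩, h3⟩
    exact ⟨h1, fun i hi => hi.elim (fun h => (h2 i h).trans (hx.2 i h).symm) (h3 i)⟩
  · rintro ⟨h1, h2⟩
    exact ⟨⟨h1, fun i hi => (h2 i (Or.inl hi)).trans (hx.2 i hi)⟩, fun i hi => h2 i (Or.inr hi)⟩

/-- Lindsey's lemma for the inner product gadget on the blocks in `K`. -/
theorem sq_sum_prod_bitSign_le (X Y : Finset (Fin n → Fin b → Bool)) (K : Finset (Fin n))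
    (P R : ℕ) (hP : ∀ x ∈ X, #(fiberOn X K x) ≤ P) (hR : ∀ y ∈ Y, #(fiberOn Y K y) ≤ R) :
    (∑ x ∈ X, ∑ y ∈ Y, ∏ i ∈ K, bitSign (IP b (x i) (y i))) ^ 2 ≤
      (#X * #Y * (P * R) * (2 ^ b) ^ #K : ℝ) := by
  let F : (K → Fin b → Bool) → ℝ := fun u => ∑ y ∈ Y, ∏ i, bitSign (IP b (u i) (K.restrict y i))
  have hF : ∀ x, ∑ y ∈ Y, ∏ i ∈ K, bitSign (IP b (x i) (y i)) = F (K.restrict x) := by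
    intro x
    refine sum_congr rfl fun y _ => ?_
    rw [← prod_coe_sort]
    rfl
  have hfib : ∀ (W : Finset (Fin n → Fin b → Bool)) (w : Fin n → Fin b → Bool),
      W.filter (fun x => K.restrict x = K.restrict w) = fiberOn W K w := by
    intro W w
    ext x
    simp [mem_fiberOn, funext_iff]
  have hF2 : ∑ u, F u ^ 2 ≤ (2 ^ b : ℝ) ^ #K * (#Y * R) := by
    have h1 : ∑ u, F u ^ 2 = ∑ y ∈ Y, ∑ y' ∈ Y,
        if K.restrict y = K.restrict y' then ((2 : ℝ) ^ b) ^ #K else 0 := by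
      simp_rw [F, sq, sum_mul_sum]
      rw [sum_comm]
      refine sum_congr rfl fun y _ => ?_
      rw [sum_comm]
      refine sum_congr rfl fun y' _ => ?_
      rw [sum_prod_bitSign_IP_mul]
      simp
    rw [h1]
    calc _ ≤ ∑ y ∈ Y, (2 ^ b : ℝ) ^ #K * R := by
          refine sum_le_sum fun y hy => ?_
          rw [← sum_filter, sum_const, nsmul_eq_mul, mul_comm]
          simp_rw [eq_comm (a := K.restrict y)]
          rw [hfib]
          gcongr
          exact hR y hy
      _ = _ := by rw [sum_const, nsmul_eq_mul]; ring
  have hX : ∑ x ∈ X, F (K.restrict x) ^ 2 ≤ P * ∑ u, F u ^ 2 := by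
    rw [← sum_fiberwise X (fun x => K.restrict x), mul_sum]
    refine sum_le_sum fun u _ => ?_
    rw [sum_congr rfl (g := fun _ => F u ^ 2) (fun x hx => by rw [(mem_filter.mp hx).2]),
      sum_const, nsmul_eq_mul]
    gcongr
    rcases (X.filter fun x => K.restrict x = u).eq_empty_or_nonempty with h | ⟨x, hx⟩
    · rw [h]; simp
    · rw [mem_filter] at hx
      rw [← hx.2, hfib]
      exact hP x hx.1
  simp_rw [hF]
  calc (∑ x ∈ X, F (K.restrict x)) ^ 2 ≤ #X * ∑ x ∈ X, F (K.restrict x) ^ 2 :=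
        sq_sum_le_card_mul_sum_sq
    _ ≤ #X * (P * ((2 ^ b : ℝ) ^ #K * (#Y * R))) := by gcongr; exact hX.trans (by gcongr)
    _ = _ := by ring

/-- A rectangle is dense on the blocks in `J` if fixing any further blocks of it shrinks it by a
factor well above `2 ^ b` per block. -/
def DenseOn (X Y : Finset (Fin n → Fin b → Bool)) (J : Finset (Fin n)) : Prop :=
  ∀ K ⊆ J, K.Nonempty → ∀ x ∈ X, ∀ y ∈ Y,
    #(fiberOn X K x) * #(fiberOn Y K y) * (16 * n ^ 2 * 2 ^ b) ^ #K ≤ #X * #Y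

theorem DenseOn.abs_sum_le {X Y : Finset (Fin n → Fin b → Bool)} {J K : Finset (Fin n)}
    (h : DenseOn X Y J) (hK : K ⊆ J) (hn : 0 < n) :
    |∑ x ∈ X, ∑ y ∈ Y, ∏ i ∈ K, bitSign (IP b (x i) (y i))| ≤
      #X * #Y * (1 / (4 * n : ℝ)) ^ #K := by
  rcases K.eq_empty_or_nonempty with rfl | hne
  · simp only [prod_empty, sum_const, nsmul_eq_mul, mul_one, card_empty, pow_zero]
    rw [abs_of_nonneg (by positivity)]
  rcases X.eq_empty_or_nonempty with rfl | hX
  · simp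
  rcases Y.eq_empty_or_nonempty with rfl | hY
  · simp
  obtain ⟨x, hx, hxm⟩ := X.exists_max_image (fun x => #(fiberOn X K x)) hX
  obtain ⟨y, hy, hym⟩ := Y.exists_max_image (fun y => #(fiberOn Y K y)) hY
  refine abs_le_of_sq_le_sq ?_ (by positivity)
  refine (sq_sum_prod_bitSign_le X Y K _ _ hxm hym).trans ?_
  have h1 : (#(fiberOn X K x) * #(fiberOn Y K y) * (16 * n ^ 2 * 2 ^ b) ^ #K : ℝ) ≤ #X * #Y := by
    exact_mod_cast h K hK hne x hx y hy
  have hn' : (0 : ℝ) < n := by exact_mod_cast hn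
  have h2 : ((1 / (4 * n : ℝ)) ^ #K) ^ 2 * (16 * n ^ 2) ^ #K = 1 := by
    rw [← pow_mul, mul_comm, mul_comm (#K), pow_mul, ← mul_pow]
    rw [show (16 * (n : ℝ) ^ 2) * (1 / (4 * n)) ^ 2 = 1 by field_simp; norm_num, one_pow]
  calc _ = (#X * #Y : ℝ) * ((1 / (4 * n : ℝ)) ^ #K) ^ 2 *
        (#(fiberOn X K x) * #(fiberOn Y K y) * (16 * n ^ 2 * 2 ^ b) ^ #K) := by
        rw [mul_pow (16 * (n : ℝ) ^ 2)]
        linear_combination (-(#X * #Y : ℝ) * (#(fiberOn X K x) * #(fiberOn Y K y)) *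
          (2 ^ b) ^ #K) * h2
    _ ≤ (#X * #Y : ℝ) * ((1 / (4 * n : ℝ)) ^ #K) ^ 2 * (#X * #Y) := by gcongr
    _ = _ := by ring

/-- On a dense rectangle every pattern of gadget values is about equally frequent. -/
theorem DenseOn.card_le {X Y : Finset (Fin n → Fin b → Bool)} {J : Finset (Fin n)}
    (h : DenseOn X Y J) (hn : 0 < n) (w : Fin n → Bool) :
    #X * #Y ≤ #((X ×ˢ Y).filter fun p => ∀ i ∈ J, IP b (p.1 i) (p.2 i) = w i) * 2 ^ (#J + 1) := by
  set G := (X ×ˢ Y).filter fun p => ∀ i ∈ J, IP b (p.1 i) (p.2 i) = w i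
  let S : Finset (Fin n) → ℝ := fun K => ∑ x ∈ X, ∑ y ∈ Y, ∏ i ∈ K, bitSign (IP b (x i) (y i))
  have hG : (#G : ℝ) * 2 ^ #J = ∑ K ∈ J.powerset, (∏ i ∈ K, bitSign (w i)) * S K := by
    have h1 : ∀ p : (Fin n → Fin b → Bool) × (Fin n → Fin b → Bool),
        (if ∀ i ∈ J, IP b (p.1 i) (p.2 i) = w i then (2 : ℝ) ^ #J else 0) =
          ∏ i ∈ J, (1 + bitSign (w i) * bitSign (IP b (p.1 i) (p.2 i))) := by
      intro p
      split_ifs with hp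
      · rw [← prod_const]
        refine prod_congr rfl fun i hi => ?_
        rw [hp i hi, bitSign_sq]; norm_num
      · push Not at hp
        obtain ⟨i, hi, hne⟩ := hp
        refine (prod_eq_zero hi ?_).symm
        revert hne
        cases IP b (p.1 i) (p.2 i) <;> cases w i <;> simp [bitSign]
    rw [← nsmul_eq_mul, ← sum_const, sum_filter]
    simp_rw [h1, prod_one_add, prod_mul_distrib]
    rw [sum_comm]
    refine sum_congr rfl fun K _ => ?_
    rw [← mul_sum, sum_product]
  have hn' : (0 : ℝ) < n := by exact_mod_cast hn
  have hexp : ∑ K ∈ J.powerset, (1 / (4 * n : ℝ)) ^ #K ≤ 3 / 2 := by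
    have h1 : ∑ K ∈ J.powerset, (1 / (4 * n : ℝ)) ^ #K = (1 + 1 / (4 * n : ℝ)) ^ #J := by
      rw [← prod_const, prod_one_add]
      simp
    rw [h1]
    have h2 : (1 + 1 / (4 * n : ℝ)) ^ #J ≤ (1 + 1 / (4 * n : ℝ)) ^ n := by
      refine pow_le_pow_right₀ (by simp) ?_
      simpa using card_le_univ J
    have h3 : (1 + 1 / (4 * n : ℝ)) ^ n ≤ Real.exp (1 / 4) := by
      calc (1 + 1 / (4 * n : ℝ)) ^ n ≤ (Real.exp (1 / (4 * n))) ^ n := by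
            gcongr
            rw [add_comm]; exact Real.add_one_le_exp _
        _ = _ := by
          rw [← Real.exp_nat_mul]; congr 1; field_simp
    have h4 : Real.exp (1 / 4) ≤ 3 / 2 := by
      refine le_of_pow_le_pow_left₀ (n := 4) (by norm_num) (by norm_num) ?_
      rw [← Real.exp_nat_mul]
      norm_num
      linarith [Real.exp_one_lt_d9]
    linarith
  have hS0 : S ∅ = #X * #Y := by simp [S]
  have hlow : (#X * #Y : ℝ) / 2 ≤ #G * 2 ^ #J := by
    rw [hG]
    have hmem : ∅ ∈ J.powerset := empty_mem_powerset J
    rw [← add_sum_erase _ _ hmem] at hexp ⊢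
    simp only [card_empty, pow_zero, prod_empty, one_mul] at hexp ⊢
    rw [hS0]
    have h1 : |∑ K ∈ J.powerset.erase ∅, (∏ i ∈ K, bitSign (w i)) * S K| ≤
        #X * #Y * ∑ K ∈ J.powerset.erase ∅, (1 / (4 * n : ℝ)) ^ #K := by
      refine (abs_sum_le_sum_abs _ _).trans ?_
      rw [mul_sum]
      refine sum_le_sum fun K hK => ?_
      rw [abs_mul, abs_prod]
      simp only [abs_bitSign, prod_const_one, one_mul]
      exact h.abs_sum_le (mem_powerset.mp (mem_of_mem_erase hK)) hn
    have h2 := (abs_le.mp h1).1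
    have h3 : (#X * #Y : ℝ) * ∑ K ∈ J.powerset.erase ∅, (1 / (4 * n : ℝ)) ^ #K ≤
        #X * #Y * (1 / 2) := by
      gcongr
      linarith
    linarith
  have : (#X * #Y : ℝ) ≤ #G * 2 ^ (#J + 1) := by rw [pow_succ]; linarith
  exact_mod_cast this

/-- Every large rectangle contains an input whose gadget values are balanced. -/
theorem exists_hw_eq_half (hn : 16 ≤ n) (he : Even n) (hb : n ^ 100 ≤ 2 ^ b)
    {X Y : Finset (Fin n → Fin b → Bool)}
    (hXY : ((2 ^ b) ^ n) ^ 2 ≤ #X * #Y * n ^ (48 * n)) :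
    ∃ x ∈ X, ∃ y ∈ Y, hw (gpow (IP b) x y) = n / 2 := by
  have hpos : 0 < #X * #Y := by
    by_contra h0
    have h0' : #X * #Y = 0 := by omega
    rw [h0', zero_mul] at hXY
    have : 0 < ((2 ^ b) ^ n) ^ 2 := by positivity
    omega
  obtain ⟨x₀, hx₀⟩ := card_pos.mp (Nat.pos_of_mul_pos_right hpos)
  obtain ⟨y₀, hy₀⟩ := card_pos.mp (Nat.pos_of_mul_pos_left hpos)
  set D := 16 * n ^ 2 * 2 ^ b with hD
  have hDpos : 0 < D := by positivity
  classical
  let Fam : Finset (Finset (Fin n)) := univ.filter fun I => ∃ x ∈ X, ∃ y ∈ Y,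
    #X * #Y ≤ #(fiberOn X I x) * #(fiberOn Y I y) * D ^ #I
  have hFam : Fam.Nonempty :=
    ⟨∅, mem_filter.mpr ⟨mem_univ _, x₀, hx₀, y₀, hy₀, by simp [fiberOn]⟩⟩
  obtain ⟨I, hI, hmax⟩ := Fam.exists_max_image card hFam
  obtain ⟨x, hx, y, hy, hxy⟩ := (mem_filter.mp hI).2
  have hdense : DenseOn (fiberOn X I x) (fiberOn Y I y) Iᶜ := by
    intro K hK hne x' hx' y' hy'
    rw [fiberOn_fiberOn hx', fiberOn_fiberOn hy']
    have hdisj : Disjoint I K := (disjoint_compl_right (a := I)).mono_right hK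
    have hcard : #(I ∪ K) = #I + #K := card_union_of_disjoint hdisj
    have hnot : I ∪ K ∉ Fam := fun hmem => by
      have := hmax _ hmem
      have := hne.card_pos
      omega
    have hlt : #(fiberOn X (I ∪ K) x') * #(fiberOn Y (I ∪ K) y') * D ^ #(I ∪ K) < #X * #Y := by
      by_contra hge
      exact hnot (mem_filter.mpr ⟨mem_univ _, x', (mem_fiberOn.mp hx').1, y',
        (mem_fiberOn.mp hy').1, not_lt.mp hge⟩)
    have h1 := hlt.le.trans hxy
    rw [hcard, pow_add, mul_comm (D ^ #I), ← mul_assoc] at h1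
    exact Nat.le_of_mul_le_mul_right h1 (by positivity)
  have hIcard : 2 * #I ≤ n := by
    have hq : 0 < (2 ^ b) ^ n := by positivity
    have h1 := card_fiberOn_mul_le X I x
    have h2 := card_fiberOn_mul_le Y I y
    set q := 2 ^ b
    have hqpos : 0 < q := by positivity
    have h3 : (q ^ n) ^ 2 * q ^ #I * q ^ #I ≤
        (q ^ n) ^ 2 * ((16 * n ^ 2) ^ #I * n ^ (48 * n)) * q ^ #I := by
      calc (q ^ n) ^ 2 * q ^ #I * q ^ #I
          ≤ (#(fiberOn X I x) * #(fiberOn Y I y) * D ^ #I * n ^ (48 * n)) * q ^ #I * q ^ #I := by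
            gcongr
            exact hXY.trans (by gcongr)
        _ = (#(fiberOn X I x) * q ^ #I) * (#(fiberOn Y I y) * q ^ #I) *
            (D ^ #I * n ^ (48 * n)) := by ring
        _ ≤ q ^ n * q ^ n * (D ^ #I * n ^ (48 * n)) := by gcongr
        _ = _ := by rw [hD, mul_pow _ q]; ring
    have h4 : q ^ #I ≤ (16 * n ^ 2) ^ #I * n ^ (48 * n) :=
      Nat.le_of_mul_le_mul_left (Nat.le_of_mul_le_mul_right h3 (by positivity))
        (by positivity : 0 < (q ^ n) ^ 2)
    have h5 : n ^ (100 * #I) ≤ n ^ (3 * #I + 48 * n) := by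
      calc n ^ (100 * #I) = (n ^ 100) ^ #I := by rw [pow_mul]
        _ ≤ q ^ #I := by gcongr
        _ ≤ _ := h4
        _ ≤ (n ^ 3) ^ #I * n ^ (48 * n) := by
          gcongr
          rw [pow_succ n 2, mul_comm]
          gcongr
        _ = _ := by rw [← pow_mul, ← pow_add]
    have h6 := (Nat.pow_le_pow_iff_right (by omega)).mp h5
    omega
  let U := I.filter fun i => IP b (x i) (y i) = true
  have hU : #U ≤ #I := card_filter_le _ _
  have hIc : #(Iᶜ) = n - #I := by rw [card_compl, Fintype.card_fin]
  obtain ⟨T, hTI, hT⟩ := exists_subset_card_eq (s := Iᶜ) (n := n / 2 - #U) (by omega)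
  have hcount := hdense.card_le (by omega) (fun i => decide (i ∈ T))
  have hxpos : 0 < #(fiberOn X I x) := card_pos.mpr ⟨x, mem_fiberOn.mpr ⟨hx, fun _ _ => rfl⟩⟩
  have hypos : 0 < #(fiberOn Y I y) := card_pos.mpr ⟨y, mem_fiberOn.mpr ⟨hy, fun _ _ => rfl⟩⟩
  have hGpos := Nat.pos_of_mul_pos_right ((Nat.mul_pos hxpos hypos).trans_le hcount)
  obtain ⟨⟨x', y'⟩, hp⟩ := card_pos.mp hGpos
  rw [mem_filter, mem_product] at hp
  obtain ⟨⟨hx', hy'⟩, hw'⟩ := hp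
  rw [mem_fiberOn] at hx' hy'
  refine ⟨x', hx'.1, y', hy'.1, ?_⟩
  have hset : (univ.filter fun i => gpow (IP b) x' y' i = true) = U ∪ T := by
    ext i
    rw [mem_filter_univ, mem_union, mem_filter]
    change IP b (x' i) (y' i) = true ↔ _
    by_cases hi : i ∈ I
    · have hiT : i ∉ T := fun h => (mem_compl.mp (hTI h)) hi
      rw [show x' i = x i from hx'.2 i hi, show y' i = y i from hy'.2 i hi]
      simp [hi, hiT]
    · have := hw' i (mem_compl.mpr hi)
      simp only at this
      rw [this]
      simp [hi]
  have hdisj : Disjoint U T :=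
    (disjoint_compl_right (a := I)).mono (filter_subset _ _) hTI
  rw [hw, hset, card_union_of_disjoint hdisj, hT]
  obtain ⟨m, rfl⟩ := he
  omega

theorem denseOn_univ_of_card_le (hb : 64 * n ^ 2 ≤ 2 ^ b)
    {X Y : Finset (Fin n → Fin b → Bool)} (hX : (2 ^ b) ^ n ≤ 2 * #X)
    (hY : (2 ^ b) ^ n ≤ 2 * #Y) : DenseOn X Y univ := by
  intro K _ hne x _ y _
  have h1 := (card_fiberOn_mul_le X K x).trans hX
  have h2 := (card_fiberOn_mul_le Y K y).trans hY
  set q := 2 ^ b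
  have h3 : 4 * (16 * n ^ 2 * q) ^ #K ≤ q ^ #K * q ^ #K := by
    calc 4 * (16 * n ^ 2 * q) ^ #K ≤ 4 ^ #K * (16 * n ^ 2 * q) ^ #K := by
          gcongr
          exact Nat.le_self_pow hne.card_pos.ne' 4
      _ = (64 * n ^ 2 * q) ^ #K := by rw [← mul_pow]; ring
      _ ≤ (q * q) ^ #K := by gcongr
      _ = _ := mul_pow _ _ _
  have h4 : 4 * (#(fiberOn X K x) * #(fiberOn Y K y) * (16 * n ^ 2 * q) ^ #K) ≤
      4 * (#X * #Y) := by
    calc _ = #(fiberOn X K x) * #(fiberOn Y K y) * (4 * (16 * n ^ 2 * q) ^ #K) := by ring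
      _ ≤ #(fiberOn X K x) * #(fiberOn Y K y) * (q ^ #K * q ^ #K) := by gcongr
      _ = (#(fiberOn X K x) * q ^ #K) * (#(fiberOn Y K y) * q ^ #K) := by ring
      _ ≤ (2 * #X) * (2 * #Y) := by gcongr
      _ = _ := by ring
  omega

theorem card_biUnion_mul_le {ι α : Type*} [DecidableEq α] (S : Finset ι) (F : ι → Finset α)
    (c m : ℕ) (h : ∀ i ∈ S, #(F i) * c ≤ m) : #(S.biUnion F) * c ≤ #S * m := by
  calc #(S.biUnion F) * c ≤ (∑ i ∈ S, #(F i)) * c := by gcongr; exact card_biUnion_le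
    _ ≤ #S * m := by rw [sum_mul, ← smul_eq_mul, ← sum_const]; exact sum_le_sum h

/-- A small number of rectangles cannot form a binary cover of the composed matrix. -/
theorem not_pBinCover (hn : 16 ≤ n) (he : Even n) (hb : n ^ 100 ≤ 2 ^ b) {r t : ℕ}
    (hrt : r < 2 ^ t) (ht : 2 ^ (t ^ 2) ≤ 4 * n ^ (2 * n)) :
    ¬ PBinCover (composed b n (IP b)) r := by
  rintro ⟨A', B', hone, hzero⟩
  classical
  let A : Fin r → Finset (Fin n → Fin b → Bool) := fun k => univ.filter (· ∈ A' k)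
  let B : Fin r → Finset (Fin n → Fin b → Bool) := fun k => univ.filter (· ∈ B' k)
  have hone' : ∀ x y, hw (gpow (IP b) x y) = n / 2 → ∃! k : Fin r, x ∈ A k ∧ y ∈ B k := by
    intro x y h
    simpa [A, B] using hone x y (by simp [composed, fPartial, h])
  have hzero' : ∀ x y, hw (gpow (IP b) x y) = 0 → ∀ k : Fin r, ¬(x ∈ A k ∧ y ∈ B k) := by
    intro x y h k
    have := hzero x y (by
      have : n / 2 ≠ 0 := by omega
      simp [composed, fPartial, h, this.symm]) k
    simpa [A, B] using this
  set q := 2 ^ b with hq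
  have hcardV : #(univ : Finset (Fin n → Fin b → Bool)) = q ^ n := by simp [hq]
  have hnn : n ≤ n ^ n := Nat.le_self_pow (by omega) n
  have h2n : 2 ^ n ≤ n ^ n := Nat.pow_le_pow_left (by omega) n
  let off : Finset (Fin r × Fin r) := univ.filter fun p => p.1 ≠ p.2
  let rowSmall : Fin r × Fin r → Prop := fun p => #(A p.1 ∩ A p.2) * n ^ (24 * n) ≤ q ^ n
  have hsmall : ∀ p ∈ off, ¬ rowSmall p → #(B p.1 ∩ B p.2) * n ^ (24 * n) ≤ q ^ n := by
    intro p hp hrow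
    by_contra hcol
    have hrow' := (not_le.mp hrow).le
    have hcol' := (not_le.mp hcol).le
    obtain ⟨x, hx, y, hy, hxy⟩ := exists_hw_eq_half hn he hb
      (X := A p.1 ∩ A p.2) (Y := B p.1 ∩ B p.2) (by
        calc (q ^ n) ^ 2 = q ^ n * q ^ n := sq _
          _ ≤ _ := Nat.mul_le_mul hrow' hcol'
          _ = _ := by rw [show 48 * n = 24 * n + 24 * n by ring, pow_add]; ring)
    rw [mem_inter] at hx hy
    exact (mem_filter.mp hp).2 ((hone' x y hxy).unique ⟨hx.1, hy.1⟩ ⟨hx.2, hy.2⟩)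
  have hoff : 2 * #off ≤ n ^ (24 * n) := by
    have h1 : #off ≤ r * r := by
      simpa using card_le_univ off
    have h2 : r * r ≤ 2 ^ t * 2 ^ t := by gcongr
    have h3 : 2 ^ t * 2 ^ t ≤ 2 * 2 ^ (t ^ 2) := by
      rw [← pow_add, ← pow_succ']
      refine Nat.pow_le_pow_right (by norm_num) ?_
      zify
      nlinarith [sq_nonneg ((t : ℤ) - 1)]
    have h4 : 16 * n ^ (2 * n) ≤ n ^ (24 * n) := by
      calc 16 * n ^ (2 * n) ≤ n ^ n * n ^ (2 * n) := by gcongr; omega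
        _ = n ^ (3 * n) := by rw [← pow_add]; ring_nf
        _ ≤ _ := Nat.pow_le_pow_right (by omega) (by omega)
    omega
  have hlarge : ∀ (F : Fin r × Fin r → Finset (Fin n → Fin b → Bool)) (S : Finset (Fin r × Fin r)),
      S ⊆ off → (∀ p ∈ S, #(F p) * n ^ (24 * n) ≤ q ^ n) → q ^ n ≤ 2 * #((S.biUnion F)ᶜ) := by
    intro F S hS hF
    have h1 := card_biUnion_mul_le S F _ _ hF
    have h2 : #S ≤ #off := card_le_card hS
    have h3 : #(S.biUnion F) * 2 * n ^ (24 * n) ≤ q ^ n * n ^ (24 * n) := by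
      calc #(S.biUnion F) * 2 * n ^ (24 * n) = 2 * (#(S.biUnion F) * n ^ (24 * n)) := by ring
        _ ≤ 2 * (#S * q ^ n) := by gcongr
        _ ≤ 2 * (#off * q ^ n) := by gcongr
        _ = q ^ n * (2 * #off) := by ring
        _ ≤ _ := by gcongr
    have h4 := Nat.le_of_mul_le_mul_right h3 (by positivity)
    have h5 : #((S.biUnion F)ᶜ) + #(S.biUnion F) = q ^ n := by
      rw [card_compl_add_card, ← hcardV, card_univ]
    omega
  let X₀ := ((off.filter rowSmall).biUnion fun p => A p.1 ∩ A p.2)ᶜ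
  let Y₀ := ((off.filter fun p => ¬ rowSmall p).biUnion fun p => B p.1 ∩ B p.2)ᶜ
  have hX₀ : q ^ n ≤ 2 * #X₀ := hlarge _ _ (filter_subset _ _) fun p hp => (mem_filter.mp hp).2
  have hY₀ : q ^ n ≤ 2 * #Y₀ := hlarge _ _ (filter_subset _ _) fun p hp =>
    hsmall p (mem_filter.mp hp).1 (mem_filter.mp hp).2
  have hb' : 64 * n ^ 2 ≤ q := by
    calc 64 * n ^ 2 ≤ n ^ 98 * n ^ 2 := by
          gcongr
          calc 64 ≤ 16 ^ 98 := by norm_num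
            _ ≤ n ^ 98 := by gcongr
      _ = n ^ 100 := by rw [← pow_add]
      _ ≤ q := hb
  let Z := (X₀ ×ˢ Y₀).filter fun p => ∀ i ∈ (univ : Finset (Fin n)), IP b (p.1 i) (p.2 i) = false
  have hZcard : #X₀ * #Y₀ ≤ #Z * 2 ^ (n + 1) := by
    have := (denseOn_univ_of_card_le hb' hX₀ hY₀).card_le (by omega) fun _ => false
    simpa only [card_univ, Fintype.card_fin] using this
  obtain ⟨X', hX', Y', hY', hav, hbig⟩ := exists_subrectangle_avoiding A B Z r t univ X₀ Y₀
    (by simpa using hrt) (by simp) (by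
      intro k _ l _ hkl
      have hmem : (k, l) ∈ off := by simpa [off] using hkl
      by_cases hs : rowSmall (k, l)
      · refine Or.inl fun x hx hxx => mem_compl.mp hx ?_
        exact mem_biUnion.mpr ⟨(k, l), mem_filter.mpr ⟨hmem, hs⟩, mem_inter.mpr hxx⟩
      · refine Or.inr fun y hy hyy => mem_compl.mp hy ?_
        exact mem_biUnion.mpr ⟨(k, l), mem_filter.mpr ⟨hmem, hs⟩, mem_inter.mpr hyy⟩) (by
      intro z hz k _
      refine hzero' z.1 z.2 ?_ k
      have hz' := (mem_filter.mp hz).2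
      rw [hw, card_eq_zero, filter_eq_empty_iff]
      intro i hi
      simp [gpow, hz' i hi])
  have hZ : Z ∩ X₀ ×ˢ Y₀ = Z := inter_eq_left.mpr (filter_subset _ _)
  rw [hZ] at hbig
  have hle : #(Z ∩ X' ×ˢ Y') ≤ #X' * #Y' := by
    rw [← card_product]; exact card_le_card inter_subset_right
  have hrt' : (r + 1) ^ t ≤ 4 * n ^ (2 * n) := by
    calc (r + 1) ^ t ≤ (2 ^ t) ^ t := by gcongr; omega
      _ = 2 ^ (t ^ 2) := by rw [← pow_mul, sq]
      _ ≤ _ := ht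
  obtain ⟨x, hx, y, hy, hxy⟩ := exists_hw_eq_half hn he hb (X := X') (Y := Y') (by
    calc (q ^ n) ^ 2 = q ^ n * q ^ n := sq _
      _ ≤ (2 * #X₀) * (2 * #Y₀) := Nat.mul_le_mul hX₀ hY₀
      _ = 4 * (#X₀ * #Y₀) := by ring
      _ ≤ 4 * ((#X' * #Y' * (4 * n ^ (2 * n))) * 2 ^ (n + 1)) := by
        refine Nat.mul_le_mul_left _ (hZcard.trans (Nat.mul_le_mul_right _ ?_))
        exact hbig.trans (Nat.mul_le_mul hle hrt')
      _ = #X' * #Y' * (32 * n ^ (2 * n) * 2 ^ n) := by ring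
      _ ≤ #X' * #Y' * ((n ^ n * n ^ n) * n ^ (2 * n) * n ^ n) := by
        gcongr
        nlinarith
      _ = #X' * #Y' * n ^ (5 * n) := by ring
      _ ≤ _ := by
        gcongr
        · omega
        · norm_num)
  obtain ⟨k, hk, _⟩ := hone' x y hxy
  exact hav k (mem_univ k) x hx y hy hk

end Blocks

theorem exists_pBinCover {α β : Type*} [Fintype α] [Fintype β] (M : α → β → Option Bool) :
    ∃ r, PBinCover M r := by
  let e := Fintype.equivFin (α × β)
  refine ⟨Fintype.card (α × β), fun k => {x | x = (e.symm k).1 ∧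
    M (e.symm k).1 (e.symm k).2 = some true}, fun k => {y | y = (e.symm k).2}, ?_, ?_⟩
  · intro i j h
    refine ⟨e (i, j), by simp [h], ?_⟩
    rintro k ⟨⟨h1, _⟩, h2⟩
    rw [← e.symm_apply_eq]
    exact Prod.ext h1.symm (Set.mem_ofPred_eq ▸ h2).symm
  · rintro i j h k ⟨⟨rfl, h1⟩, h2⟩
    rw [Set.mem_ofPred_eq] at h2
    rw [h2, h1] at h
    simp at h

theorem pow_le_two_pow_bOf {n : ℕ} (hn : 0 < n) : n ^ 100 ≤ 2 ^ bOf n := by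
  have hn' : (0 : ℝ) < n := by exact_mod_cast hn
  have h : (n : ℝ) ^ 100 ≤ 2 ^ bOf n := by
    calc (n : ℝ) ^ 100 = (2 : ℝ) ^ ((100 : ℝ) * Real.logb 2 n) := by
          rw [mul_comm, Real.rpow_mul (by norm_num), Real.rpow_logb (by norm_num) (by norm_num) hn']
          norm_cast
      _ ≤ (2 : ℝ) ^ (bOf n : ℝ) :=
        Real.rpow_le_rpow_of_exponent_le (by norm_num) (Nat.le_ceil _)
      _ = _ := Real.rpow_natCast _ _
  exact_mod_cast h

theorem two_pow_sq_ceil_sqrt_le {n : ℕ} (hn : 0 < n) :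
    2 ^ (⌈Real.sqrt (n * Real.logb 2 n)⌉₊ ^ 2) ≤ 4 * n ^ (2 * n) := by
  have hn' : (0 : ℝ) < n := by exact_mod_cast hn
  have hL : 0 ≤ (n : ℝ) * Real.logb 2 n :=
    mul_nonneg hn'.le (Real.logb_nonneg (by norm_num) (by exact_mod_cast hn))
  set s := Real.sqrt (n * Real.logb 2 n) with hs
  have hs2 : s ^ 2 = n * Real.logb 2 n := Real.sq_sqrt hL
  have hs0 : 0 ≤ s := Real.sqrt_nonneg _
  have ht : (⌈s⌉₊ : ℝ) ≤ s + 1 := (Nat.ceil_lt_add_one hs0).le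
  have ht2 : ((⌈s⌉₊ ^ 2 : ℕ) : ℝ) ≤ 2 + Real.logb 2 n * (2 * n : ℕ) := by
    push_cast
    nlinarith [sq_nonneg (s - 1), Nat.cast_nonneg (α := ℝ) ⌈s⌉₊]
  have h : (2 : ℝ) ^ (⌈s⌉₊ ^ 2) ≤ 4 * n ^ (2 * n) := by
    rw [← Real.rpow_natCast]
    refine (Real.rpow_le_rpow_of_exponent_le (by norm_num) ht2).trans_eq ?_
    rw [Real.rpow_add (by norm_num), Real.rpow_mul (by norm_num),
      Real.rpow_logb (by norm_num) (by norm_num) hn', Real.rpow_natCast]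
    norm_num
  exact_mod_cast h

/-- There is a constant `ε > 0` such that for all sufficiently large
even `n`, the composed partial matrix `f ∘ gⁿ` with the confounding gadget `g` has
binary rank at least `2 ^ (ε · √(n · log₂ n))`. -/
theorem pbinRank_composed_lower :
    ∃ ε : ℝ, 0 < ε ∧ ∃ N : ℕ, ∀ n : ℕ, N ≤ n → Even n →
      (2 : ℝ) ^ (ε * Real.sqrt (n * Real.logb 2 n)) ≤
        (pbinRank (composed (bOf n) n (IP (bOf n))) : ℝ) := by
  refine ⟨1, one_pos, 16, fun n hn he => ?_⟩
  rw [one_mul]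
  by_contra hlt
  rw [not_le] at hlt
  refine not_pBinCover hn he (pow_le_two_pow_bOf (by omega)) ?_
    (two_pow_sq_ceil_sqrt_le (by omega))
    (Nat.sInf_mem (exists_pBinCover (composed (bOf n) n (IP (bOf n)))))
  have h := hlt.trans_le (Real.rpow_le_rpow_of_exponent_le one_le_two (Nat.le_ceil _))
  rw [Real.rpow_natCast] at h
  exact_mod_cast h
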